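/- (Proposition 3, third smoothness inequality.) Let p, p' ∈ ℝ^K have nonnegative entries such that β_m·Ξ_m(q) ≤ μ₀ for every m and every q on the segment joining p and p'. Then max_{1≤m≤M} |β_m Ξ_m(p) − β_m Ξ_m(p')| ≤ L₂·‖p − p'‖₁, where L₂ = max_m (β_m a_m b_m ξBT H_m/(D_m ln 2 · σ²))·(μ₀/(β_m a_m))^{1+1/b_m}. -/

import Mathlib

open Finset

/-- Total number of collected samples (minus A_m) of task m in the asymptotic regime:
Σ_{k∈Y} (ξBT/D_m) log₂(1 + G_kk p_k/σ²). -/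
noncomputable def Srate {K : ℕ} (G : Fin K → ℝ) (σ2 ξ B T Dm : ℝ)
    (Y : Finset (Fin K)) (p : Fin K → ℝ) : ℝ :=
  ∑ k ∈ Y, ξ * B * T / Dm * Real.logb 2 (1 + G k * p k / σ2)

/-- Asymptotic classification error Ξ_m(p) of task m. -/
noncomputable def Xi {K : ℕ} (G : Fin K → ℝ) (σ2 ξ B T Dm Am am bm : ℝ)
    (Y : Finset (Fin K)) (p : Fin K → ℝ) : ℝ :=
  am * (Srate G σ2 ξ B T Dm Y p + Am) ^ (-bm)

/-- Partial derivative ∂Ξ_m/∂p_j (closed form, eq. (24) of the paper). -/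
noncomputable def dXi {K : ℕ} (G : Fin K → ℝ) (σ2 ξ B T Dm Am am bm : ℝ)
    (Y : Finset (Fin K)) (p : Fin K → ℝ) (j : Fin K) : ℝ :=
  -(am * bm * (ξ * B * T) * (if j ∈ Y then (1 : ℝ) else 0)
      / (Dm * Real.log 2 * (σ2 / G j + p j)))
    * (Srate G σ2 ξ B T Dm Y p + Am) ^ (-bm - 1)

/-- The constant H_m = ‖(𝟙_{Y}(1) G_11, …, 𝟙_{Y}(K) G_KK)‖₂. -/
noncomputable def Hconst {K : ℕ} (G : Fin K → ℝ) (Y : Finset (Fin K)) : ℝ :=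
  Real.sqrt (∑ j, (if j ∈ Y then G j else 0) ^ 2)

lemma aux_rpow (b c x y : ℝ) (hb : 0 < b) (hc : 0 < c) (hx : c ≤ x) (hy : c ≤ y) :
    |x ^ (-b) - y ^ (-b)| ≤ b * c ^ (-b - 1) * |x - y| := by
  have h := Convex.norm_image_sub_le_of_norm_hasDerivWithin_le (𝕜 := ℝ)
    (f := fun t : ℝ => t ^ (-b)) (f' := fun t : ℝ => (-b) * t ^ (-b - 1)) (s := Set.Ici c)
    (x := y) (y := x) (C := b * c ^ (-b - 1)) ?_ ?_ (convex_Ici c) hy hx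
  · simpa [Real.norm_eq_abs] using h
  · intro t ht
    have ht0 : 0 < t := lt_of_lt_of_le hc ht
    exact (Real.hasDerivAt_rpow_const (Or.inl ht0.ne')).hasDerivWithinAt
  · intro t ht
    have ht0 : 0 < t := lt_of_lt_of_le hc ht
    have h1 : 0 < t ^ (-b - 1) := Real.rpow_pos_of_pos ht0 _
    rw [Real.norm_eq_abs, abs_mul, abs_neg, abs_of_pos hb, abs_of_pos h1]
    exact mul_le_mul_of_nonneg_left
      (Real.rpow_le_rpow_of_nonpos hc ht (by linarith)) hb.le

lemma aux_log (u v : ℝ) (hu : 0 ≤ u) (hv : 0 ≤ v) :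
    |Real.log (1 + u) - Real.log (1 + v)| ≤ |u - v| := by
  have key : ∀ u v : ℝ, 0 ≤ v → v ≤ u → Real.log (1 + u) - Real.log (1 + v) ≤ u - v := by
    intro u v hv huv
    rw [← Real.log_div (by linarith) (by linarith)]
    have h := Real.log_le_sub_one_of_pos (x := (1 + u) / (1 + v))
      (div_pos (by linarith) (by linarith))
    have h2 : (1 + u) / (1 + v) - 1 ≤ u - v := by
      rw [div_sub_one (by linarith), div_le_iff₀ (by linarith)]
      nlinarith
    linarith
  rcases le_total v u with h | h
  · have h1 := Real.log_le_log (x := 1 + v) (y := 1 + u) (by linarith) (by linarith)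
    rw [abs_of_nonneg (by linarith), abs_of_nonneg (by linarith)]
    exact key u v hv h
  · have h1 := Real.log_le_log (x := 1 + u) (y := 1 + v) (by linarith) (by linarith)
    rw [abs_of_nonpos (by linarith), abs_of_nonpos (by linarith)]
    linarith [key v u hu h]

lemma aux_H {K : ℕ} (G : Fin K → ℝ) (Y : Finset (Fin K)) (k : Fin K) (hk : k ∈ Y) :
    G k ≤ Hconst G Y := by
  unfold Hconst
  apply Real.le_sqrt_of_sq_le
  have h := Finset.single_le_sum (f := fun j => (if j ∈ Y then G j else 0) ^ 2)
    (fun i _ => sq_nonneg _) (Finset.mem_univ k)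
  simpa [hk] using h

lemma aux_S {K : ℕ} (G : Fin K → ℝ) (σ2 ξ B T Dm : ℝ) (Y : Finset (Fin K))
    (p p' : Fin K → ℝ) (hG : ∀ k, 0 < G k) (hσ : 0 < σ2) (hξ : 0 < ξ) (hB : 0 < B)
    (hT : 0 < T) (hD : 0 < Dm) (hp : ∀ k, 0 ≤ p k) (hp' : ∀ k, 0 ≤ p' k) :
    |Srate G σ2 ξ B T Dm Y p - Srate G σ2 ξ B T Dm Y p'|
      ≤ (ξ * B * T) * Hconst G Y / (Dm * Real.log 2 * σ2) * ∑ k, |p k - p' k| := by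
  have hl : 0 < Real.log 2 := Real.log_pos (by norm_num)
  have hH : 0 ≤ Hconst G Y := Real.sqrt_nonneg _
  unfold Srate
  rw [← Finset.sum_sub_distrib, Finset.mul_sum]
  refine (Finset.abs_sum_le_sum_abs _ _).trans ?_
  refine le_trans (Finset.sum_le_sum (fun k hk => ?_))
    (Finset.sum_le_sum_of_subset_of_nonneg (Finset.subset_univ Y)
      (f := fun k => (ξ * B * T) * Hconst G Y / (Dm * Real.log 2 * σ2) * |p k - p' k|)
      (fun i _ _ => by positivity))
  have h1 := aux_log (G k * p k / σ2) (G k * p' k / σ2)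
    (div_nonneg (mul_nonneg (hG k).le (hp k)) hσ.le)
    (div_nonneg (mul_nonneg (hG k).le (hp' k)) hσ.le)
  have h2 : G k * p k / σ2 - G k * p' k / σ2 = G k / σ2 * (p k - p' k) := by ring
  rw [h2, abs_mul, abs_of_pos (div_pos (hG k) hσ)] at h1
  have h3 : G k / σ2 * |p k - p' k| ≤ Hconst G Y / σ2 * |p k - p' k| := by
    have := aux_H G Y k hk
    gcongr
  have e : ξ * B * T / Dm * Real.logb 2 (1 + G k * p k / σ2)
      - ξ * B * T / Dm * Real.logb 2 (1 + G k * p' k / σ2)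
      = ξ * B * T / (Dm * Real.log 2)
        * (Real.log (1 + G k * p k / σ2) - Real.log (1 + G k * p' k / σ2)) := by
    unfold Real.logb
    field_simp
  have hc : 0 < ξ * B * T / (Dm * Real.log 2) := by positivity
  rw [e, abs_mul, abs_of_pos hc]
  calc _ ≤ ξ * B * T / (Dm * Real.log 2) * (Hconst G Y / σ2 * |p k - p' k|) :=
        mul_le_mul_of_nonneg_left (h1.trans h3) hc.le
    _ = _ := by field_simp

lemma aux_Snn {K : ℕ} (G : Fin K → ℝ) (σ2 ξ B T Dm : ℝ) (Y : Finset (Fin K))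
    (p : Fin K → ℝ) (hG : ∀ k, 0 < G k) (hσ : 0 < σ2) (hξ : 0 < ξ) (hB : 0 < B)
    (hT : 0 < T) (hD : 0 < Dm) (hp : ∀ k, 0 ≤ p k) :
    0 ≤ Srate G σ2 ξ B T Dm Y p := by
  unfold Srate
  refine Finset.sum_nonneg (fun k _ => mul_nonneg (by positivity) ?_)
  have := div_nonneg (mul_nonneg (hG k).le (hp k)) hσ.le
  exact Real.logb_nonneg (by norm_num) (by linarith)

lemma aux_c (μ0 a b β c : ℝ) (ha : 0 < a) (hb : 0 < b) (hβ : 1 ≤ β) (hc : 0 < c)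
    (h : β * (a * c ^ (-b)) ≤ μ0) :
    c ^ (-b - 1) ≤ (μ0 / (β * a)) ^ (1 + 1 / b) := by
  have hβ0 : 0 < β := by linarith
  have e : c ^ (-b - 1) = (c ^ (-b)) ^ (1 + 1 / b) := by
    rw [← Real.rpow_mul hc.le]
    congr 1
    field_simp
    ring
  rw [e]
  apply Real.rpow_le_rpow (Real.rpow_nonneg hc.le _) _ (by positivity)
  rw [le_div_iff₀ (by positivity)]
  linarith

/-- Proposition 3, third smoothness inequality. -/
theorem smoothness_L2_p {K M : ℕ} [NeZero K] [NeZero M]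
    (G : Fin K → ℝ) (σ2 ξ B T μ0 : ℝ)
    (Y : Fin M → Finset (Fin K)) (D A a b β : Fin M → ℝ)
    (p p' : Fin K → ℝ)
    (hG : ∀ k, 0 < G k) (hσ : 0 < σ2) (hξ : 0 < ξ) (hB : 0 < B) (hT : 0 < T)
    (hμ0 : 0 < μ0)
    (hY : ∀ m, (Y m).Nonempty) (hD : ∀ m, 0 < D m) (hA : ∀ m, 0 < A m)
    (ha : ∀ m, 0 < a m) (hb : ∀ m, 0 < b m) (hβ : ∀ m, 1 ≤ β m)
    (hp : ∀ k, 0 ≤ p k) (hp' : ∀ k, 0 ≤ p' k)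
    (hseg : ∀ m, ∀ q ∈ segment ℝ p p',
      β m * Xi G σ2 ξ B T (D m) (A m) (a m) (b m) (Y m) q ≤ μ0) :
    (Finset.univ.sup' Finset.univ_nonempty (fun m : Fin M =>
        |β m * Xi G σ2 ξ B T (D m) (A m) (a m) (b m) (Y m) p
          - β m * Xi G σ2 ξ B T (D m) (A m) (a m) (b m) (Y m) p'|))
      ≤ (Finset.univ.sup' Finset.univ_nonempty (fun m : Fin M =>
          β m * a m * b m * (ξ * B * T) * Hconst G (Y m) / (D m * Real.log 2 * σ2)
            * (μ0 / (β m * a m)) ^ (1 + 1 / b m)))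
        * ∑ k, |p k - p' k| := by
  apply Finset.sup'_le
  intro m _
  refine le_trans ?_ (mul_le_mul_of_nonneg_right
    (Finset.le_sup' (fun m : Fin M =>
          β m * a m * b m * (ξ * B * T) * Hconst G (Y m) / (D m * Real.log 2 * σ2)
            * (μ0 / (β m * a m)) ^ (1 + 1 / b m)) (Finset.mem_univ m))
    (Finset.sum_nonneg (fun k _ => abs_nonneg _)))
  have h1 := hseg m p (left_mem_segment ℝ p p')
  have h2 := hseg m p' (right_mem_segment ℝ p p')
  have n1 := aux_Snn G σ2 ξ B T (D m) (Y m) p hG hσ hξ hB hT (hD m) hp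
  have n2 := aux_Snn G σ2 ξ B T (D m) (Y m) p' hG hσ hξ hB hT (hD m) hp'
  have hS := aux_S G σ2 ξ B T (D m) (Y m) p p' hG hσ hξ hB hT (hD m) hp hp'
  have hA' := hA m
  have ha' := ha m
  have hb' := hb m
  have hβ0 : 0 < β m := by linarith [hβ m]
  unfold Xi at *
  set s := Srate G σ2 ξ B T (D m) (Y m) p
  set s' := Srate G σ2 ξ B T (D m) (Y m) p'
  have hc : 0 < min (s + A m) (s' + A m) := lt_min (by linarith) (by linarith)
  have hcc : min (s + A m) (s' + A m) ^ (-b m - 1) ≤ (μ0 / (β m * a m)) ^ (1 + 1 / b m) := by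
    apply aux_c μ0 (a m) (b m) (β m) _ ha' hb' (hβ m) hc
    rcases min_choice (s + A m) (s' + A m) with h | h <;> rw [h] <;> assumption
  have hr := aux_rpow (b m) _ (s + A m) (s' + A m) hb' hc (min_le_left _ _) (min_le_right _ _)
  rw [add_sub_add_right_eq_sub] at hr
  have hP : 0 ≤ (μ0 / (β m * a m)) ^ (1 + 1 / b m) := by positivity
  rw [← mul_sub, ← mul_sub, ← mul_assoc, abs_mul, abs_of_pos (mul_pos hβ0 ha')]
  have h5 : |(s + A m) ^ (-b m) - (s' + A m) ^ (-b m)|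
      ≤ b m * (μ0 / (β m * a m)) ^ (1 + 1 / b m)
        * ((ξ * B * T) * Hconst G (Y m) / (D m * Real.log 2 * σ2) * ∑ k, |p k - p' k|) :=
    hr.trans (mul_le_mul (mul_le_mul_of_nonneg_left hcc hb'.le) hS (abs_nonneg _)
      (mul_nonneg hb'.le hP))
  refine (mul_le_mul_of_nonneg_left h5 (mul_pos hβ0 ha').le).trans (le_of_eq ?_)
  ring
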